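/- There exists a universal constant c > 0 such that for every N ≥ 1, every integer k ≥ 1 with 2k ≤ √N, all sequences x = (x₁,…,x_k), y = (y₁,…,y_k) ∈ [N]^k and every integer 0 ≤ k₀ ≤ k, one has |E[ ∏_{t=1}^{k₀} M̲_{x_t y_t} · ∏_{t=k₀+1}^{k} M_{x_t y_t} ]| ≤ c · 2^b · (1/N)^a · (3k/√N)^{a₁}, where a := |A_{x,y}|, b is the number of inconsistent arcs of (x,y), and a₁ is the number of indices 1 ≤ t ≤ k₀ such that the arc (x_t,y_t) is consistent and has multiplicity one. -/

import Mathlib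

open scoped Classical

noncomputable section

/-- Permutation matrix `M_{xy} = 1(σ(x) = y)`. -/
def permMat {N : ℕ} (σ : Equiv.Perm (Fin N)) : Matrix (Fin N) (Fin N) ℝ :=
  Matrix.of fun x y => if σ x = y then 1 else 0

/-- The `N×N` all-ones matrix `𝟙⊗𝟙`. -/
def onesMat (N : ℕ) : Matrix (Fin N) (Fin N) ℝ := Matrix.of fun _ _ => 1

/-- The centered permutation matrix `M̲ = M − (1/N)·𝟙⊗𝟙`. -/
def centMat {N : ℕ} (σ : Equiv.Perm (Fin N)) : Matrix (Fin N) (Fin N) ℝ :=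
  permMat σ - (N : ℝ)⁻¹ • onesMat N

/-- The set of arcs `A_{x,y} = {(x_t, y_t) : t ∈ [k]}`. -/
def arcSet {N k : ℕ} (x y : Fin k → Fin N) : Finset (Fin N × Fin N) :=
  Finset.image (fun t => (x t, y t)) Finset.univ

/-- An arc `e` is consistent when `{t : (x_t,y_t) = e} = {t : x_t = e.1} = {t : y_t = e.2}`. -/
def Consistent {N k : ℕ} (x y : Fin k → Fin N) (e : Fin N × Fin N) : Prop :=
  {t | (x t, y t) = e} = {t | x t = e.1} ∧ {t | (x t, y t) = e} = {t | y t = e.2}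

/-- The multiplicity `m(e) = #{t : (x_t,y_t) = e}` of an arc. -/
def arcMult {N k : ℕ} (x y : Fin k → Fin N) (e : Fin N × Fin N) : ℕ :=
  (Finset.univ.filter fun t => (x t, y t) = e).card

end

/-- A finite set of arcs is a partial matching when it is the graph of a partial injection. -/
def IsPartialMatching {N : ℕ} (V : Finset (Fin N × Fin N)) : Prop :=
  Set.InjOn Prod.fst (V : Set (Fin N × Fin N)) ∧ Set.InjOn Prod.snd (V : Set (Fin N × Fin N))

/-- `N ^ n / (N)_n`, the normalized probability that a uniform permutation contains a given
partial matching with `n` arcs. -/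
noncomputable def normMatchProb (N n : ℕ) : ℝ := (N : ℝ) ^ n / (N.descFactorial n : ℝ)

/-- Iterated forward differences of `normMatchProb`. -/
noncomputable def diffMatchProb (N : ℕ) : ℕ → ℕ → ℝ
  | 0, n => normMatchProb N n
  | s + 1, n => diffMatchProb N s (n + 1) - diffMatchProb N s n

theorem normMatchProb_succ {N n : ℕ} (h : n < N) :
    normMatchProb N (n + 1) * ((N : ℝ) - n) = normMatchProb N n * N := by
  have h1 : (N.descFactorial n : ℝ) ≠ 0 := by
    exact_mod_cast (Nat.descFactorial_pos.2 h.le).ne'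
  have h2 : ((N : ℝ) - n) ≠ 0 := by
    have : (n : ℝ) < N := by exact_mod_cast h
    linarith
  unfold normMatchProb
  rw [Nat.descFactorial_succ]
  push_cast [Nat.cast_sub h.le]
  field_simp
  ring

theorem normMatchProb_pos {N n : ℕ} (h : n ≤ N) (hN : 0 < N) : 0 < normMatchProb N n := by
  have h1 : (0 : ℝ) < (N.descFactorial n : ℝ) := by
    exact_mod_cast Nat.descFactorial_pos.2 h
  unfold normMatchProb
  positivity

theorem normMatchProb_mul_le {N n : ℕ} (h : n ≤ N) (hN : 0 < N) :
    normMatchProb N n * ((N : ℝ) - n ^ 2) ≤ N := by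
  induction n with
  | zero => simp [normMatchProb]
  | succ n ih =>
    have ih := ih (by omega)
    have hr := normMatchProb_succ (N := N) (n := n) h
    have hp := normMatchProb_pos h hN
    have hnN : (n : ℝ) + 1 ≤ N := by exact_mod_cast h
    have hn : (0 : ℝ) ≤ n := n.cast_nonneg
    have hN' : (0 : ℝ) < N := by exact_mod_cast hN
    refine le_of_mul_le_mul_right ?_ hN'
    have h1 : normMatchProb N (n + 1) * ((N : ℝ) - (n + 1) ^ 2) * N ≤
        normMatchProb N (n + 1) * (((N : ℝ) - n) * (N - n ^ 2)) := by
      rw [mul_assoc]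
      refine mul_le_mul_of_nonneg_left ?_ hp.le
      have : (0 : ℝ) ≤ n ^ 3 := by positivity
      nlinarith [mul_nonneg hn hN'.le]
    have h2 : normMatchProb N (n + 1) * (((N : ℝ) - n) * (N - n ^ 2)) =
        normMatchProb N n * (N - n ^ 2) * N := by
      rw [← mul_assoc, hr]; ring
    push_cast
    nlinarith

theorem normMatchProb_le_two {N n : ℕ} (h : 4 * n ^ 2 ≤ N) (hN : 0 < N) :
    normMatchProb N n ≤ 2 := by
  have hn : n ≤ N := by nlinarith
  have h1 := normMatchProb_mul_le hn hN
  have h2 := normMatchProb_pos hn hN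
  have h3 : 4 * (n : ℝ) ^ 2 ≤ N := by exact_mod_cast h
  have hN' : (0 : ℝ) < N := by exact_mod_cast hN
  by_contra! hc
  nlinarith

theorem diffMatchProb_succ {N : ℕ} (s n : ℕ) (h : n + s < N) :
    diffMatchProb N (s + 1) n = n / N * diffMatchProb N s (n + 1) +
      s / N * diffMatchProb N (s - 1) (n + 2) := by
  induction s generalizing n with
  | zero =>
    have hr := normMatchProb_succ (N := N) (n := n) (by omega)
    have hN : (N : ℝ) ≠ 0 := by
      have : 0 < N := by omega
      positivity
    simp only [diffMatchProb]
    field_simp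
    simp
    linarith
  | succ s ih =>
    have h1 := ih (n + 1) (by omega)
    have h2 := ih n (by omega)
    have h3 : diffMatchProb N (s + 1) (n + 1) =
      diffMatchProb N s (n + 2) - diffMatchProb N s (n + 1) := rfl
    rw [show diffMatchProb N (s + 1 + 1) n =
      diffMatchProb N (s + 1) (n + 1) - diffMatchProb N (s + 1) n from rfl]
    rcases s with _ | s
    · push_cast at *
      linear_combination h1 - h2 - n / N * h3
    · have h4 : diffMatchProb N (s + 1) (n + 2) =
        diffMatchProb N s (n + 3) - diffMatchProb N s (n + 2) := rfl
      simp only [Nat.add_sub_cancel] at *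
      push_cast at *
      linear_combination h1 - h2 - n / N * h3 - (s + 1) / N * h4

theorem diffMatchProb_bounds {N k : ℕ} {r : ℝ} (hk : 1 ≤ k) (hkN : 4 * k ^ 2 ≤ N)
    (hr0 : 0 ≤ r) (hr2 : r ≤ 2) (hr : 9 * (k : ℝ) ^ 2 / N ≤ r ^ 2) (hr1 : (k : ℝ) / N ≤ r) :
    ∀ s n : ℕ, n + s ≤ k → 0 ≤ diffMatchProb N s n ∧ diffMatchProb N s n ≤ 2 * r ^ s
  | 0, n, h => by
    have hN : 0 < N := by nlinarith
    have : n ^ 2 ≤ k ^ 2 := Nat.pow_le_pow_left (by omega) 2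
    simp only [diffMatchProb, pow_zero, mul_one]
    exact ⟨(normMatchProb_pos (by nlinarith) hN).le, normMatchProb_le_two (by omega) hN⟩
  | 1, n, h => by
    have h0 := diffMatchProb_bounds hk hkN hr0 hr2 hr hr1 0 (n + 1) (by omega)
    rw [diffMatchProb_succ 0 n (by nlinarith)]
    have hnk : (n : ℝ) / N ≤ k / N := by
      gcongr
      omega
    have hn : (0 : ℝ) ≤ (n : ℝ) / N := by positivity
    simp only [pow_zero, mul_one, Nat.cast_zero, zero_div, zero_mul, add_zero, pow_one] at *
    refine ⟨mul_nonneg hn h0.1, ?_⟩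
    nlinarith [h0.1, h0.2]
  | s + 2, n, h => by
    have h0 := diffMatchProb_bounds hk hkN hr0 hr2 hr hr1 s (n + 2) (by omega)
    have h1 := diffMatchProb_bounds hk hkN hr0 hr2 hr hr1 (s + 1) (n + 1) (by omega)
    rw [diffMatchProb_succ (s + 1) n (by nlinarith)]
    have hnk : (n : ℝ) / N ≤ k / N := by
      gcongr
      omega
    have hsk : ((s + 1 : ℕ) : ℝ) / N ≤ k / N := by
      gcongr
      omega
    have hn : (0 : ℝ) ≤ (n : ℝ) / N := by positivity
    have hs : (0 : ℝ) ≤ ((s + 1 : ℕ) : ℝ) / N := by positivity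
    have hk0 : (0 : ℝ) ≤ (k : ℝ) / N := by positivity
    refine ⟨add_nonneg (mul_nonneg hn h1.1) (mul_nonneg hs h0.1), ?_⟩
    have e1 : (n : ℝ) / N * diffMatchProb N (s + 1) (n + 1) ≤ k / N * (2 * r ^ (s + 1)) :=
      mul_le_mul hnk h1.2 h1.1 hk0
    have e2 : ((s + 1 : ℕ) : ℝ) / N * diffMatchProb N (s + 1 - 1) (n + 2) ≤
        k / N * (2 * r ^ s) := mul_le_mul hsk h0.2 h0.1 hk0
    have e3 : (k : ℝ) / N * (r + 1) ≤ r ^ 2 := by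
      have hk1 : (1 : ℝ) ≤ k := by exact_mod_cast hk
      have : (k : ℝ) / N * k = k ^ 2 / N := by ring
      have h9 : 9 * (k : ℝ) ^ 2 / N = 9 * ((k : ℝ) / N * k) := by ring
      rw [h9] at hr
      nlinarith
    have e4 : 2 * r ^ s * ((k : ℝ) / N * (r + 1)) ≤ 2 * r ^ s * r ^ 2 :=
      mul_le_mul_of_nonneg_left e3 (by positivity)
    calc _ ≤ k / N * (2 * r ^ (s + 1)) + k / N * (2 * r ^ s) := add_le_add e1 e2
      _ = 2 * r ^ s * ((k : ℝ) / N * (r + 1)) := by ring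
      _ ≤ _ := e4
      _ = _ := by ring

theorem prod_permMat_eq_ite {N : ℕ} (σ : Equiv.Perm (Fin N)) (V : Finset (Fin N × Fin N)) :
    ∏ e ∈ V, permMat σ e.1 e.2 = if ∀ e ∈ V, σ e.1 = e.2 then 1 else 0 := by
  simp [permMat, Finset.prod_ite_zero]

theorem prod_permMat_eq_zero {N : ℕ} (σ : Equiv.Perm (Fin N)) {V : Finset (Fin N × Fin N)}
    (hV : ¬ IsPartialMatching V) : ∏ e ∈ V, permMat σ e.1 e.2 = 0 := by
  rw [prod_permMat_eq_ite, if_neg]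
  intro h
  refine hV ⟨fun e he f hf hef => ?_, fun e he f hf hef => ?_⟩
  · exact Prod.ext hef (by rw [← h e he, ← h f hf, hef])
  · exact Prod.ext (σ.injective (by rw [h e he, h f hf, hef])) hef

theorem IsPartialMatching.exists_perm {N : ℕ} {V : Finset (Fin N × Fin N)}
    (hV : IsPartialMatching V) : ∃ τ : Equiv.Perm (Fin N), ∀ e ∈ V, τ e.1 = e.2 := by
  let f : V ≃ Set.range (fun e : V => e.1.1) :=
    Equiv.ofInjective _ fun e f h => Subtype.ext (hV.1 e.2 f.2 h)
  let g : V ≃ Set.range (fun e : V => e.1.2) :=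
    Equiv.ofInjective _ fun e f h => Subtype.ext (hV.2 e.2 f.2 h)
  refine ⟨(f.symm.trans g).extendSubtype, fun e he => ?_⟩
  rw [Equiv.extendSubtype_apply_of_mem _ e.1 ⟨⟨e, he⟩, rfl⟩]
  have : f.symm ⟨e.1, ⟨⟨e, he⟩, rfl⟩⟩ = ⟨e, he⟩ := by
    rw [Equiv.symm_apply_eq]; rfl
  simp only [Equiv.trans_apply, this]
  rfl

theorem IsPartialMatching.card_perm {N : ℕ} {V : Finset (Fin N × Fin N)}
    (hV : IsPartialMatching V) :
    (Finset.univ.filter fun σ : Equiv.Perm (Fin N) => ∀ e ∈ V, σ e.1 = e.2).card =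
      (N - V.card).factorial := by
  obtain ⟨τ, hτ⟩ := hV.exists_perm
  have hcard : (V.image Prod.fst).card = V.card := Finset.card_image_of_injOn hV.1
  have e1 : {σ : Equiv.Perm (Fin N) // ∀ e ∈ V, σ e.1 = e.2} ≃
      {σ : Equiv.Perm (Fin N) // ∀ a, ¬ a ∉ V.image Prod.fst → σ a = a} :=
    (Equiv.mulLeft τ⁻¹).subtypeEquiv fun σ => by
      constructor
      · intro h a ha
        obtain ⟨e, he, rfl⟩ := Finset.mem_image.1 (not_not.1 ha)
        simp [h e he, ← hτ e he]
      · intro h e he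
        have := h e.1 (not_not.2 (Finset.mem_image_of_mem _ he))
        rw [← hτ e he]
        exact Equiv.Perm.inv_eq_iff_eq.1 this
  have e2 := e1.trans (Equiv.Perm.subtypeEquivSubtypePerm fun a => a ∉ V.image Prod.fst).symm
  rw [← Fintype.card_subtype, Fintype.card_congr e2, Fintype.card_perm,
    Fintype.card_subtype_compl, Fintype.card_fin, Fintype.card_coe, hcard]

open scoped BigOperators in
theorem IsPartialMatching.expect_prod_permMat {N : ℕ} {V : Finset (Fin N × Fin N)}
    (hV : IsPartialMatching V) :
    𝔼 σ : Equiv.Perm (Fin N), ∏ e ∈ V, permMat σ e.1 e.2 =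
      (N : ℝ)⁻¹ ^ V.card * normMatchProb N V.card := by
  have hle : V.card ≤ N := by
    rw [← Finset.card_image_of_injOn hV.1]
    simpa using Finset.card_le_univ (V.image Prod.fst)
  have hpow : (N : ℝ) ^ V.card ≠ 0 := by
    rcases Nat.eq_zero_or_pos N with rfl | h
    · simp [Nat.le_zero.1 hle]
    · positivity
  simp only [prod_permMat_eq_ite]
  rw [Fintype.expect_eq_sum_div_card, Finset.sum_boole, hV.card_perm, Fintype.card_perm,
    Fintype.card_fin, ← Nat.factorial_mul_descFactorial hle, normMatchProb]
  have h1 := (N - V.card).factorial_ne_zero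
  have h2 := (Nat.descFactorial_pos.2 hle).ne'
  push_cast [inv_pow]
  field_simp

open scoped BigOperators in
theorem IsPartialMatching.expect_prod_centered {N : ℕ} (S : Finset (Fin N × Fin N)) :
    ∀ V : Finset (Fin N × Fin N), IsPartialMatching (S ∪ V) → Disjoint S V →
    𝔼 σ : Equiv.Perm (Fin N), (∏ e ∈ S, (permMat σ e.1 e.2 - (N : ℝ)⁻¹)) *
        ∏ e ∈ V, permMat σ e.1 e.2 =
      (N : ℝ)⁻¹ ^ (S.card + V.card) * diffMatchProb N S.card V.card := by
  induction S using Finset.induction_on with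
  | empty =>
    intro V hV _
    rw [Finset.empty_union] at hV
    simpa [diffMatchProb] using hV.expect_prod_permMat
  | insert e S he ih =>
    intro V hV hd
    rw [Finset.disjoint_insert_left] at hd
    have h1 := ih (insert e V) (by rwa [Finset.union_insert, ← Finset.insert_union])
      (Finset.disjoint_insert_right.2 ⟨he, hd.2⟩)
    have h2 := ih V (by
      refine ⟨hV.1.mono ?_, hV.2.mono ?_⟩ <;>
      · rw [Finset.insert_union]
        exact_mod_cast Finset.subset_insert _ _) hd.2
    rw [Finset.card_insert_of_notMem hd.1] at h1
    simp only [Finset.prod_insert hd.1] at h1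
    rw [Finset.card_insert_of_notMem he, diffMatchProb]
    have : ∀ σ : Equiv.Perm (Fin N),
        (∏ e ∈ insert e S, (permMat σ e.1 e.2 - (N : ℝ)⁻¹)) * ∏ e ∈ V, permMat σ e.1 e.2 =
        (∏ e ∈ S, (permMat σ e.1 e.2 - (N : ℝ)⁻¹)) *
          (permMat σ e.1 e.2 * ∏ e ∈ V, permMat σ e.1 e.2) -
        (N : ℝ)⁻¹ * ((∏ e ∈ S, (permMat σ e.1 e.2 - (N : ℝ)⁻¹)) *
          ∏ e ∈ V, permMat σ e.1 e.2) := by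
      intro σ
      rw [Finset.prod_insert he]
      ring
    simp only [this]
    rw [Finset.expect_sub_distrib, ← Finset.mul_expect, h1, h2]
    ring

open scoped BigOperators in
theorem abs_expect_mul_prod_le {Ω ι : Type*} [Fintype Ω] (O : Finset ι) (F : Ω → ℝ)
    (X : Ω → ι → ℝ) (α β : ι → ℝ) {B u : ℝ}
    (h : ∀ V ⊆ O, |𝔼 ω, F ω * ∏ e ∈ V, X ω e| ≤ B * u ^ V.card) :
    |𝔼 ω, F ω * ∏ e ∈ O, (α e * X ω e + β e)| ≤ B * ∏ e ∈ O, (|α e| * u + |β e|) := by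
  have h1 : ∀ ω, F ω * ∏ e ∈ O, (α e * X ω e + β e) =
      ∑ V ∈ O.powerset, ((∏ e ∈ V, α e) * ∏ e ∈ O \ V, β e) * (F ω * ∏ e ∈ V, X ω e) := by
    intro ω
    rw [Finset.prod_add, Finset.mul_sum]
    refine Finset.sum_congr rfl fun V _ => ?_
    rw [Finset.prod_mul_distrib]
    ring
  simp only [h1]
  rw [Finset.expect_sum_comm, Finset.prod_add, Finset.mul_sum]
  refine (Finset.abs_sum_le_sum_abs _ _).trans (Finset.sum_le_sum fun V hV => ?_)
  rw [← Finset.mul_expect, abs_mul, abs_mul, Finset.abs_prod, Finset.abs_prod,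
    Finset.prod_mul_distrib, Finset.prod_const]
  have := h V (Finset.mem_powerset.1 hV)
  calc _ ≤ ((∏ e ∈ V, |α e|) * ∏ e ∈ O \ V, |β e|) * (B * u ^ V.card) := by gcongr
    _ = _ := by ring

theorem permMat_eq_zero_or_one {N : ℕ} (σ : Equiv.Perm (Fin N)) (x y : Fin N) :
    permMat σ x y = 0 ∨ permMat σ x y = 1 := by
  simp only [permMat, Matrix.of_apply]
  split_ifs <;> simp

theorem centMat_apply {N : ℕ} (σ : Equiv.Perm (Fin N)) (x y : Fin N) :
    centMat σ x y = permMat σ x y - (N : ℝ)⁻¹ := by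
  simp [centMat, onesMat]

/-- A consistent arc shares neither its source nor its target with another arc. -/
theorem Consistent.eq_of_mem {N k : ℕ} {x y : Fin k → Fin N} {e f : Fin N × Fin N}
    (he : Consistent x y e) (hf : f ∈ arcSet x y) (h : f.1 = e.1 ∨ f.2 = e.2) : f = e := by
  obtain ⟨t, -, rfl⟩ := Finset.mem_image.1 hf
  rcases h with h | h
  · exact he.1.symm.subset h
  · exact he.2.symm.subset h

theorem isPartialMatching_union {N k : ℕ} {x y : Fin k → Fin N} {S V : Finset (Fin N × Fin N)}
    (hS : ∀ e ∈ S, e ∈ arcSet x y ∧ Consistent x y e) (hVA : V ⊆ arcSet x y)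
    (hV : IsPartialMatching V) : IsPartialMatching (S ∪ V) := by
  constructor
  all_goals
    intro e he f hf hef
    simp only [Finset.coe_union, Set.mem_union, Finset.mem_coe] at he hf
    rcases he with he | he
    · have hfA : f ∈ arcSet x y := hf.elim (fun h => (hS f h).1) (fun h => hVA h)
      exact ((hS e he).2.eq_of_mem hfA (by simp_all)).symm
    rcases hf with hf | hf
    · exact (hS f hf).2.eq_of_mem (hVA he) (by simp_all)
  · exact hV.1 he hf hef
  · exact hV.2 he hf hef

theorem card_arcSet_le {N k : ℕ} (x y : Fin k → Fin N) : (arcSet x y).card ≤ k := by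
  simpa [arcSet] using Finset.card_image_le (s := Finset.univ) (f := fun t : Fin k => (x t, y t))

open scoped BigOperators in
theorem abs_expect_prod_centered_le {N k : ℕ} {r : ℝ} {x y : Fin k → Fin N}
    {S V : Finset (Fin N × Fin N)} (hk : 1 ≤ k) (hkN : 4 * k ^ 2 ≤ N)
    (hr0 : 0 ≤ r) (hr2 : r ≤ 2) (hr : 9 * (k : ℝ) ^ 2 / N ≤ r ^ 2) (hr1 : (k : ℝ) / N ≤ r)
    (hS : ∀ e ∈ S, e ∈ arcSet x y ∧ Consistent x y e) (hVA : V ⊆ arcSet x y \ S) :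
    |𝔼 σ : Equiv.Perm (Fin N), (∏ e ∈ S, (permMat σ e.1 e.2 - (N : ℝ)⁻¹)) *
        ∏ e ∈ V, permMat σ e.1 e.2| ≤
      2 * r ^ S.card * (N : ℝ)⁻¹ ^ S.card * (N : ℝ)⁻¹ ^ V.card := by
  by_cases hV : IsPartialMatching V
  · have hSV : Disjoint S V := Finset.disjoint_left.2 fun e he heV =>
      (Finset.mem_sdiff.1 (hVA heV)).2 he
    have hVA' : V ⊆ arcSet x y := hVA.trans Finset.sdiff_subset
    have hcard : V.card + S.card ≤ k := by
      rw [add_comm, ← Finset.card_union_of_disjoint hSV]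
      exact (Finset.card_le_card (Finset.union_subset (fun e he => (hS e he).1) hVA')).trans
        (card_arcSet_le x y)
    have hb := diffMatchProb_bounds hk hkN hr0 hr2 hr hr1 S.card V.card hcard
    rw [IsPartialMatching.expect_prod_centered S V (isPartialMatching_union hS hVA' hV) hSV,
      abs_of_nonneg (mul_nonneg (by positivity) hb.1)]
    calc _ ≤ (N : ℝ)⁻¹ ^ (S.card + V.card) * (2 * r ^ S.card) := by
          gcongr
          exact hb.2
      _ = _ := by ring
  · simp only [prod_permMat_eq_zero _ hV, mul_zero, Finset.expect_const_zero, abs_zero]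
    positivity

/-- The product over the occurrences of one arc, evaluated where the matrix entry is `v`. -/
noncomputable def arcValue {N k : ℕ} (x y : Fin k → Fin N) (k₀ : ℕ) (v : ℝ)
    (e : Fin N × Fin N) : ℝ :=
  ∏ t : Fin k with (x t, y t) = e, if t.val < k₀ then v - (N : ℝ)⁻¹ else v

theorem arcValue_permMat {N k : ℕ} (x y : Fin k → Fin N) (k₀ : ℕ) (σ : Equiv.Perm (Fin N))
    (e : Fin N × Fin N) :
    arcValue x y k₀ (permMat σ e.1 e.2) e =
      (arcValue x y k₀ 1 e - arcValue x y k₀ 0 e) * permMat σ e.1 e.2 + arcValue x y k₀ 0 e := by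
  rcases permMat_eq_zero_or_one σ e.1 e.2 with h | h <;> rw [h] <;> ring

theorem prod_eq_prod_arcValue {N k : ℕ} (x y : Fin k → Fin N) (k₀ : ℕ)
    (σ : Equiv.Perm (Fin N)) :
    ∏ t : Fin k, (if t.val < k₀ then centMat σ (x t) (y t) else permMat σ (x t) (y t)) =
      ∏ e ∈ arcSet x y, arcValue x y k₀ (permMat σ e.1 e.2) e := by
  rw [← Finset.prod_fiberwise_of_maps_to (s := Finset.univ) (t := arcSet x y)
    (g := fun t => (x t, y t)) fun t _ => Finset.mem_image_of_mem _ (Finset.mem_univ t)]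
  refine Finset.prod_congr rfl fun e _ => Finset.prod_congr rfl fun t ht => ?_
  obtain rfl := (Finset.mem_filter.1 ht).2
  simp only [centMat_apply]

theorem abs_arcValue_one_le {N k : ℕ} (x y : Fin k → Fin N) (k₀ : ℕ) (hN : 1 ≤ N)
    (e : Fin N × Fin N) : |arcValue x y k₀ 1 e| ≤ 1 := by
  have hu : (N : ℝ)⁻¹ ≤ 1 := inv_le_one_of_one_le₀ (by exact_mod_cast hN)
  have hu0 : 0 ≤ (N : ℝ)⁻¹ := by positivity
  rw [arcValue, Finset.abs_prod]
  refine Finset.prod_le_one (fun _ _ => abs_nonneg _) fun t _ => ?_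
  split_ifs <;> rw [abs_le] <;> constructor <;> linarith

theorem abs_arcValue_zero_le {N k : ℕ} (x y : Fin k → Fin N) (k₀ : ℕ) (e : Fin N × Fin N) :
    |arcValue x y k₀ 0 e| ≤ (N : ℝ)⁻¹ ^ arcMult x y e := by
  rw [arcValue, Finset.abs_prod, arcMult, ← Finset.prod_const]
  refine Finset.prod_le_prod (fun _ _ => abs_nonneg _) fun t _ => ?_
  split_ifs <;> simp

theorem arcMult_pos {N k : ℕ} {x y : Fin k → Fin N} {e : Fin N × Fin N}
    (he : e ∈ arcSet x y) : 0 < arcMult x y e := by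
  obtain ⟨t, -, rfl⟩ := Finset.mem_image.1 he
  exact Finset.card_pos.2 ⟨t, by simp⟩

theorem arcValue_of_arcMult_eq_one {N k : ℕ} {x y : Fin k → Fin N} (k₀ : ℕ) (v : ℝ) (t : Fin k)
    (h : arcMult x y (x t, y t) = 1) :
    arcValue x y k₀ v (x t, y t) = if t.val < k₀ then v - (N : ℝ)⁻¹ else v := by
  obtain ⟨s, hs⟩ := Finset.card_eq_one.1 h
  have : t ∈ ({s} : Finset (Fin k)) := by
    rw [← hs]
    simp
  obtain rfl := Finset.mem_singleton.1 this
  rw [arcValue, hs, Finset.prod_singleton]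

/-- The indices counted by the exponent of `3k/√N`. -/
noncomputable def simpleCentered {N k : ℕ} (x y : Fin k → Fin N) (k₀ : ℕ) : Finset (Fin k) :=
  Finset.univ.filter fun t : Fin k =>
    t.val < k₀ ∧ Consistent x y (x t, y t) ∧ arcMult x y (x t, y t) = 1

theorem card_image_simpleCentered {N k : ℕ} (x y : Fin k → Fin N) (k₀ : ℕ) :
    ((simpleCentered x y k₀).image fun t => (x t, y t)).card = (simpleCentered x y k₀).card := by
  refine Finset.card_image_of_injOn fun s hs t _ hst => ?_
  have hs := (Finset.mem_filter.1 hs).2.2.2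
  exact Finset.card_le_one.1 hs.le s (by simp) t (by simpa using hst.symm)

theorem abs_coeff_le {N k : ℕ} {x y : Fin k → Fin N} {k₀ : ℕ} (hN : 1 ≤ N)
    {e : Fin N × Fin N}
    (he : e ∈ arcSet x y \ (simpleCentered x y k₀).image fun t => (x t, y t)) :
    |arcValue x y k₀ 1 e - arcValue x y k₀ 0 e| * (N : ℝ)⁻¹ + |arcValue x y k₀ 0 e| ≤
      (N : ℝ)⁻¹ * ((1 + 2 * (N : ℝ)⁻¹) * if Consistent x y e then 1 else 2) := by
  obtain ⟨heA, heS⟩ := Finset.mem_sdiff.1 he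
  have hu : (N : ℝ)⁻¹ ≤ 1 := inv_le_one_of_one_le₀ (by exact_mod_cast hN)
  have hu0 : 0 ≤ (N : ℝ)⁻¹ := by positivity
  have h1 := abs_arcValue_one_le x y k₀ hN e
  have h0 := abs_arcValue_zero_le x y k₀ e
  have hm := arcMult_pos heA
  have hsub := (abs_sub (arcValue x y k₀ 1 e) (arcValue x y k₀ 0 e)).trans
    (add_le_add h1 le_rfl)
  have hmul := mul_le_mul_of_nonneg_right hsub hu0
  set u := (N : ℝ)⁻¹
  by_cases hc : Consistent x y e
  · have h2 : |arcValue x y k₀ 0 e| ≤ u ^ 2 := by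
      rcases (Nat.succ_le_of_lt hm).eq_or_lt with h | h
      · obtain ⟨t, -, rfl⟩ := Finset.mem_image.1 heA
        have ht : ¬ t.val < k₀ := fun ht => heS <| Finset.mem_image.2
          ⟨t, by simpa [simpleCentered] using ⟨ht, hc, h.symm⟩, rfl⟩
        rw [arcValue_of_arcMult_eq_one k₀ 0 t h.symm, if_neg ht, abs_zero]
        positivity
      · exact h0.trans (pow_le_pow_of_le_one hu0 hu h)
    rw [if_pos hc]
    nlinarith
  · have h2 : |arcValue x y k₀ 0 e| ≤ u := by
      simpa using h0.trans (pow_le_pow_of_le_one hu0 hu hm)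
    rw [if_neg hc]
    nlinarith

theorem prod_coeff_bound_le {N k : ℕ} (x y : Fin k → Fin N) {O : Finset (Fin N × Fin N)}
    (hO : O ⊆ arcSet x y) (hkN : 2 * k ≤ N) :
    ∏ e ∈ O, ((N : ℝ)⁻¹ * ((1 + 2 * (N : ℝ)⁻¹) * if Consistent x y e then 1 else 2)) ≤
      (N : ℝ)⁻¹ ^ O.card *
        (Real.exp 1 * 2 ^ ((arcSet x y).filter fun e => ¬ Consistent x y e).card) := by
  have hOk : O.card ≤ k := (Finset.card_le_card hO).trans (card_arcSet_le x y)
  rw [Finset.prod_mul_distrib, Finset.prod_mul_distrib, Finset.prod_const, Finset.prod_const,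
    Finset.prod_ite, Finset.prod_const_one, Finset.prod_const, one_mul]
  have hexp : (1 + 2 * (N : ℝ)⁻¹) ^ O.card ≤ Real.exp 1 := by
    have h1 : 1 + 2 * (N : ℝ)⁻¹ ≤ Real.exp (2 * (N : ℝ)⁻¹) := by
      linarith [Real.add_one_le_exp (2 * (N : ℝ)⁻¹)]
    calc _ ≤ Real.exp (2 * (N : ℝ)⁻¹) ^ O.card := by gcongr
      _ = Real.exp (O.card * (2 * (N : ℝ)⁻¹)) := (Real.exp_nat_mul _ _).symm
      _ ≤ Real.exp 1 := by
        rw [Real.exp_le_exp, ← mul_assoc]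
        refine mul_inv_le_one_of_le₀ ?_ (by positivity)
        exact_mod_cast (by omega : O.card * 2 ≤ N)
  gcongr
  norm_num

/-- there is a universal constant `c > 0` such that for all `N`, `k ≥ 1` with
`2k ≤ √N`, all `x, y ∈ [N]^k` and `0 ≤ k₀ ≤ k`:
`|E[∏_{t ≤ k₀} M̲_{x_t y_t} · ∏_{t > k₀} M_{x_t y_t}]| ≤ c·2^b·(1/N)^a·(3k/√N)^{a₁}`, where
`a` is the number of arcs, `b` the number of inconsistent arcs, and `a₁` the number of
`t ≤ k₀` whose arc is consistent of multiplicity one. -/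
theorem stmt7 :
    ∃ c : ℝ, 0 < c ∧
      ∀ N k : ℕ, 1 ≤ k → (2 * k : ℝ) ≤ Real.sqrt N →
        ∀ x y : Fin k → Fin N, ∀ k₀ : ℕ, k₀ ≤ k →
          |(Fintype.card (Equiv.Perm (Fin N)) : ℝ)⁻¹ *
              ∑ σ : Equiv.Perm (Fin N), ∏ t : Fin k,
                (if t.val < k₀ then centMat σ (x t) (y t) else permMat σ (x t) (y t))| ≤
            c * 2 ^ (((arcSet x y).filter fun e => ¬ Consistent x y e).card) *
              ((N : ℝ)⁻¹) ^ (arcSet x y).card *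
              (3 * k / Real.sqrt N) ^
                ((Finset.univ.filter fun t : Fin k =>
                  t.val < k₀ ∧ Consistent x y (x t, y t) ∧ arcMult x y (x t, y t) = 1).card) := by
  refine ⟨2 * Real.exp 1, by positivity, fun N k hk hkN x y k₀ _ => ?_⟩
  have hk1 : (1 : ℝ) ≤ k := by exact_mod_cast hk
  have hsq : Real.sqrt N * Real.sqrt N = N := Real.mul_self_sqrt N.cast_nonneg
  have hs : (0 : ℝ) < Real.sqrt N := by linarith
  have hkN2 : 4 * k ^ 2 ≤ N := by
    have : 4 * (k : ℝ) ^ 2 ≤ N := by nlinarith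
    exact_mod_cast this
  have hN : 1 ≤ N := by nlinarith
  set r : ℝ := 3 * k / Real.sqrt N with hrdef
  have hr0 : 0 ≤ r := by positivity
  have hr2 : r ≤ 2 := by
    rw [hrdef, div_le_iff₀ hs]
    linarith
  have hr : 9 * (k : ℝ) ^ 2 / N ≤ r ^ 2 := by
    rw [hrdef, div_pow, Real.sq_sqrt N.cast_nonneg]
    exact le_of_eq (by ring)
  have hr1 : (k : ℝ) / N ≤ r := by
    have hsN : Real.sqrt N ≤ N := by nlinarith
    rw [hrdef]
    gcongr
    linarith
  set S := (simpleCentered x y k₀).image fun t => (x t, y t) with hSdef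
  have hS : ∀ e ∈ S, e ∈ arcSet x y ∧ Consistent x y e := by
    intro e he
    obtain ⟨t, ht, rfl⟩ := Finset.mem_image.1 he
    exact ⟨Finset.mem_image_of_mem _ (Finset.mem_univ t), (Finset.mem_filter.1 ht).2.2.1⟩
  have hSA : S ⊆ arcSet x y := fun e he => (hS e he).1
  have hfactor : ∀ σ : Equiv.Perm (Fin N),
      ∏ t : Fin k, (if t.val < k₀ then centMat σ (x t) (y t) else permMat σ (x t) (y t)) =
      (∏ e ∈ S, (permMat σ e.1 e.2 - (N : ℝ)⁻¹)) * ∏ e ∈ arcSet x y \ S,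
        ((arcValue x y k₀ 1 e - arcValue x y k₀ 0 e) * permMat σ e.1 e.2 +
          arcValue x y k₀ 0 e) := by
    intro σ
    rw [prod_eq_prod_arcValue, ← Finset.prod_sdiff hSA, mul_comm]
    congr 1
    · refine Finset.prod_congr rfl fun e he => ?_
      obtain ⟨t, ht, rfl⟩ := Finset.mem_image.1 he
      have ht := (Finset.mem_filter.1 ht).2
      rw [arcValue_of_arcMult_eq_one _ _ t ht.2.2, if_pos ht.1]
    · exact Finset.prod_congr rfl fun e _ => arcValue_permMat x y k₀ σ e
  have hmain := abs_expect_mul_prod_le (arcSet x y \ S)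
    (fun σ : Equiv.Perm (Fin N) => ∏ e ∈ S, (permMat σ e.1 e.2 - (N : ℝ)⁻¹))
    (fun σ e => permMat σ e.1 e.2) (fun e => arcValue x y k₀ 1 e - arcValue x y k₀ 0 e)
    (arcValue x y k₀ 0) fun V hV =>
      abs_expect_prod_centered_le hk hkN2 hr0 hr2 hr hr1 hS hV
  have hprod := (Finset.prod_le_prod (fun e _ => by positivity)
    fun e he => abs_coeff_le hN he).trans
      (prod_coeff_bound_le x y (Finset.sdiff_subset (t := S)) (by nlinarith : 2 * k ≤ N))
  simp only [hfactor]
  rw [Fintype.expect_eq_sum_div_card, div_eq_inv_mul] at hmain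
  refine hmain.trans ((mul_le_mul_of_nonneg_left hprod (by positivity)).trans_eq ?_)
  have hcard : (Finset.univ.filter fun t : Fin k => t.val < k₀ ∧ Consistent x y (x t, y t) ∧
      arcMult x y (x t, y t) = 1).card = S.card := (card_image_simpleCentered x y k₀).symm
  rw [hcard, ← Finset.card_sdiff_add_card_eq_card hSA, pow_add]
  ring
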